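/- Consider the 3-person edge-symmetric terminal game with positions u₁,u₂,u₃ where player i controls uᵢ, terminals a₁,a₂,a₃, and edge set consisting of (uᵢ,uⱼ) for all i≠j together with (uᵢ,aᵢ) for i=1,2,3, where the terminal costs are 𝓛¹(a₁)=−2, 𝓛¹(a₂)=−3, 𝓛¹(a₃)=−1; 𝓛²(a₁)=−1, 𝓛²(a₂)=−2, 𝓛²(a₃)=−3; 𝓛³(a₁)=−3, 𝓛³(a₂)=−1, 𝓛³(a₃)=−2 (so condition (CIW) holds). This game has no uniform Nash equilibrium in pure stationary strategies. -/

import Mathlib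

open scoped Classical

section CoreDefs

variable {V : Type}

/-- A position is terminal iff it has no outgoing edges. -/
def Terminal (E : V → V → Prop) (v : V) : Prop := ∀ u, ¬ E v u

/-- A situation (profile of pure stationary strategies), encoded as a single
successor map: at every non-terminal position it must follow an edge. -/
def IsSituation (E : V → V → Prop) (s : V → V) : Prop :=
  ∀ v, ¬ Terminal E v → E v (s v)

/-- `s'` is a unilateral deviation of player `i` from `s`: they agree at every
position not controlled by `i` (terminals are controlled by nobody). -/
def Deviation {n : ℕ} (E : V → V → Prop) (owner : V → Fin n) (i : Fin n)
    (s s' : V → V) : Prop :=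
  ∀ v, (owner v ≠ i ∨ Terminal E v) → s' v = s v

/-- The play of `s` started at `v` reaches a terminal position. -/
def Reaches (E : V → V → Prop) (s : V → V) (v : V) : Prop :=
  ∃ k, Terminal E (s^[k] v)

/-- First time the play of `s` from `v` is at a terminal position. -/
noncomputable def stopTime (E : V → V → Prop) (s : V → V) (v : V) : ℕ :=
  sInf {k | Terminal E (s^[k] v)}

/-- The terminal position reached by the play of `s` from `v` (junk if none). -/
noncomputable def playEnd (E : V → V → Prop) (s : V → V) (v : V) : V :=
  s^[stopTime E s v] v

/-- Effective cost in a terminal game: the cost of the terminal reached,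
`0` for an infinite play. -/
noncomputable def tCost (E : V → V → Prop) (L : V → ℝ) (s : V → V) (v : V) : ℝ :=
  if Reaches E s v then L (playEnd E s v) else 0

/-- Effective cost in a positive shortest path game: the total length of the
play if it terminates, `+∞` for an infinite play. -/
noncomputable def spCost (E : V → V → Prop) (l : V → V → ℝ) (s : V → V) (v : V) : EReal :=
  if Reaches E s v then
    (((Finset.range (stopTime E s v)).sum fun k => l (s^[k] v) (s^[k+1] v) : ℝ) : EReal)
  else ⊤

/-- Edge-symmetry: every move can be reversed, except moves entering terminals. -/
def EdgeSymm (E : V → V → Prop) : Prop :=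
  ∀ u v, E u v → ¬ Terminal E v → E v u

end CoreDefs
section UniformDefs

variable {V : Type}

/-- `s` is a situation in which player `i`'s strategy is a uniform best
response to the opponents' strategies: no unilateral deviation of `i`
improves `i`'s cost from any initial position. -/
def UBR {n : ℕ} (E : V → V → Prop) (owner : V → Fin n) (L : Fin n → V → ℝ)
    (i : Fin n) (s : V → V) : Prop :=
  ∀ s', IsSituation E s' → Deviation E owner i s s' →
    ∀ v, tCost E (L i) s v ≤ tCost E (L i) s' v

/-- `s'` is obtained from `s` by a uniform best improvement of player `i`. -/
def UBI {n : ℕ} (E : V → V → Prop) (owner : V → Fin n) (L : Fin n → V → ℝ)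
    (i : Fin n) (s s' : V → V) : Prop :=
  IsSituation E s' ∧ Deviation E owner i s s' ∧ s' ≠ s ∧
  UBR E owner L i s' ∧
  ∀ v, owner v = i → ¬ Terminal E v →
    s' v = s v ∨ tCost E (L i) s' v < tCost E (L i) s v

/-- `s` is `i`-basic: every position `v` with a terminal out-neighbour `w`
either uses the terminal move, or every uniform best improvement of player `i`
gives the owner of `v` a strictly better value at `v` than that terminal. -/
def IBasic {n : ℕ} (E : V → V → Prop) (owner : V → Fin n) (L : Fin n → V → ℝ)
    (i : Fin n) (s : V → V) : Prop :=
  ∀ v w, E v w → Terminal E w →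
    s v = w ∨ ∀ s', UBI E owner L i s s' → tCost E (L (owner v)) s' v < L (owner v) w

/-- (S1): every edge between two distinct non-terminal vertices joins positions
of different players. -/
def CondS1 {n : ℕ} (E : V → V → Prop) (owner : V → Fin n) : Prop :=
  ∀ u v, E u v → u ≠ v → ¬ Terminal E u → ¬ Terminal E v → owner u ≠ owner v

/-- (S2): every position has at most one terminal out-neighbour. -/
def CondS2 (E : V → V → Prop) : Prop :=
  ∀ v w w', E v w → E v w' → Terminal E w → Terminal E w' → w = w'

/-- (S3): a terminal position is reachable from every position. -/
def CondS3 (E : V → V → Prop) : Prop :=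
  ∀ v : V, ∃ w, Terminal E w ∧ Relation.ReflTransGen E v w

/-- Uniform Nash equilibrium: a situation that is a Nash equilibrium for every
choice of the initial position. -/
def IsUNE {n : ℕ} (E : V → V → Prop) (owner : V → Fin n) (L : Fin n → V → ℝ)
    (s : V → V) : Prop :=
  IsSituation E s ∧ ∀ i s', IsSituation E s' → Deviation E owner i s s' →
    ∀ v, tCost E (L i) s v ≤ tCost E (L i) s' v

end UniformDefs

/- Vertices: `0 = u₁`, `1 = u₂`, `2 = u₃` (position `uᵢ` controlled by player
`i`), and terminals `3 = a₁`, `4 = a₂`, `5 = a₃`. -/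

/-- Edge set: `(uᵢ, uⱼ)` for all `i ≠ j`, together with `(uᵢ, aᵢ)` for
`i = 1, 2, 3`. -/
def E19 : Fin 6 → Fin 6 → Prop := fun a b =>
  (a = 0 ∧ b = 1) ∨ (a = 0 ∧ b = 2) ∨ (a = 1 ∧ b = 0) ∨ (a = 1 ∧ b = 2) ∨
  (a = 2 ∧ b = 0) ∨ (a = 2 ∧ b = 1) ∨
  (a = 0 ∧ b = 3) ∨ (a = 1 ∧ b = 4) ∨ (a = 2 ∧ b = 5)

/-- Player `i` controls `uᵢ`. -/
def owner19 : Fin 6 → Fin 3 := ![0, 1, 2, 0, 0, 0]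

/-- Terminal costs: `𝓛¹ = (-2, -3, -1)`, `𝓛² = (-1, -2, -3)`,
`𝓛³ = (-3, -1, -2)` on `(a₁, a₂, a₃)`; all negative, so (CIW) holds. -/
noncomputable def L19 : Fin 3 → Fin 6 → ℝ :=
  ![![0, 0, 0, -2, -3, -1], ![0, 0, 0, -1, -2, -3], ![0, 0, 0, -3, -1, -2]]

section PlayCosts

variable {V : Type} {E : V → V → Prop} {s : V → V} {v : V}

theorem tCost_of_terminal (L : V → ℝ) (hv : Terminal E v) : tCost E L s v = L v := by
  have hr : Reaches E s v := ⟨0, hv⟩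
  have ht : stopTime E s v = 0 := Nat.sInf_eq_zero.2 (Or.inl hv)
  rw [tCost, if_pos hr, playEnd, ht, Function.iterate_zero, id]

theorem reaches_step (hv : ¬ Terminal E v) : Reaches E s (s v) ↔ Reaches E s v := by
  constructor
  · rintro ⟨k, hk⟩
    exact ⟨k + 1, hk⟩
  · rintro ⟨_ | k, hk⟩
    · exact absurd hk hv
    · exact ⟨k, hk⟩

theorem stopTime_step (hv : ¬ Terminal E v) (hr : Reaches E s v) :
    stopTime E s v = stopTime E s (s v) + 1 := by
  have hr' := (reaches_step hv).2 hr
  apply le_antisymm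
  · exact Nat.sInf_le (show Terminal E (s^[stopTime E s (s v)] (s v)) from Nat.sInf_mem hr')
  · have hmem : Terminal E (s^[stopTime E s v] v) := Nat.sInf_mem hr
    cases h : stopTime E s v with
    | zero => rw [h] at hmem; exact absurd hmem hv
    | succ k => rw [h] at hmem; exact Nat.succ_le_succ (Nat.sInf_le hmem)

theorem tCost_step (L : V → ℝ) (hv : ¬ Terminal E v) :
    tCost E L s v = tCost E L s (s v) := by
  by_cases hr : Reaches E s v
  · rw [tCost, tCost, if_pos hr, if_pos ((reaches_step hv).2 hr), playEnd, playEnd,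
      stopTime_step hv hr, Function.iterate_succ_apply]
  · rw [tCost, tCost, if_neg hr, if_neg (mt (reaches_step hv).1 hr)]

theorem tCost_of_mapsTo (L : V → ℝ) (S : Set V) (hS : Set.MapsTo s S S)
    (hT : ∀ u ∈ S, ¬ Terminal E u) (hv : v ∈ S) : tCost E L s v = 0 :=
  if_neg fun ⟨k, hk⟩ => hT _ (hS.iterate k hv) hk

/-- Redirecting a single position is a deviation of its owner, so it does not pay off in a
uniform Nash equilibrium. -/
theorem IsUNE.tCost_le_update {n : ℕ} {owner : V → Fin n} {L : Fin n → V → ℝ}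
    (h : IsUNE E owner L s) {w : V} (hw : E v w) :
    tCost E (L (owner v)) s v ≤ tCost E (L (owner v)) (Function.update s v w) w := by
  have hv : ¬ Terminal E v := fun ht => ht w hw
  have key := h.2 (owner v) (Function.update s v w) ?_ ?_ v
  · rwa [tCost_step (s := Function.update s v w) _ hv, Function.update_self] at key
  · intro u hu
    by_cases huv : u = v
    · subst huv; rwa [Function.update_self]
    · rw [Function.update_of_ne huv]; exact h.1 u hu
  · intro u hu
    have huv : u ≠ v := by rintro rfl; exact hu.elim (fun h => h rfl) hv
    exact Function.update_of_ne huv _ _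

theorem IsUNE.tCost_le_exit {n : ℕ} {owner : V → Fin n} {L : Fin n → V → ℝ}
    (h : IsUNE E owner L s) {w : V} (hw : E v w) (ht : Terminal E w) :
    tCost E (L (owner v)) s v ≤ L (owner v) w :=
  (h.tCost_le_update hw).trans_eq (tCost_of_terminal _ ht)

theorem IsUNE.tCost_le_exit_next {n : ℕ} {owner : V → Fin n} {L : Fin n → V → ℝ}
    (h : IsUNE E owner L s) {u : V} (hu : E v u) (hne : u ≠ v) (hnt : ¬ Terminal E u)
    (ht : Terminal E (s u)) :
    tCost E (L (owner v)) s v ≤ L (owner v) (s u) := by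
  refine (h.tCost_le_update hu).trans_eq ?_
  rw [tCost_step _ hnt, Function.update_of_ne hne, tCost_of_terminal _ ht]

end PlayCosts

theorem terminal_E19_iff (v : Fin 6) : Terminal E19 v ↔ 3 ≤ v := by
  unfold Terminal E19
  revert v
  decide

/-- This 3-person edge-symmetric terminal game satisfying
(CIW) (the symmetrized game `Γ³` of Boros–Elbassioni–Gurvich–Makino) has no
uniform Nash equilibrium in pure stationary strategies. -/
theorem example19_no_UNE :
    EdgeSymm E19 ∧
    (∀ (i : Fin 3) (w : Fin 6), Terminal E19 w → L19 i w < 0) ∧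
    ¬ ∃ s : Fin 6 → Fin 6, IsUNE E19 owner19 L19 s := by
  refine ⟨?_, ?_, ?_⟩
  · intro u v
    rw [terminal_E19_iff]
    unfold E19
    revert u v
    decide
  · intro i w hw
    rw [terminal_E19_iff] at hw
    fin_cases i <;> fin_cases w <;> first | (exact absurd hw (by decide)) | norm_num [L19]
  · rintro ⟨s, h⟩
    have nt0 : ¬ Terminal E19 0 := by rw [terminal_E19_iff]; decide
    have nt1 : ¬ Terminal E19 1 := by rw [terminal_E19_iff]; decide
    have nt2 : ¬ Terminal E19 2 := by rw [terminal_E19_iff]; decide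
    have t3 : Terminal E19 3 := by rw [terminal_E19_iff]
    have t4 : Terminal E19 4 := by rw [terminal_E19_iff]; decide
    have t5 : Terminal E19 5 := by rw [terminal_E19_iff]; decide
    have exit0 : tCost E19 (L19 0) s 0 ≤ -2 := h.tCost_le_exit (v := 0) (by simp [E19]) t3
    have exit1 : tCost E19 (L19 1) s 1 ≤ -2 := h.tCost_le_exit (v := 1) (by simp [E19]) t4
    have exit2 : tCost E19 (L19 2) s 2 ≤ -2 := h.tCost_le_exit (v := 2) (by simp [E19]) t5
    have next0 (e : s 1 = 4) : tCost E19 (L19 0) s 0 ≤ -3 := by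
      have := h.tCost_le_exit_next (v := 0) (u := 1) (by simp [E19]) (by decide) nt1 (e ▸ t4)
      rwa [e] at this
    have next1 (e : s 2 = 5) : tCost E19 (L19 1) s 1 ≤ -3 := by
      have := h.tCost_le_exit_next (v := 1) (u := 2) (by simp [E19]) (by decide) nt2 (e ▸ t5)
      rwa [e] at this
    have next2 (e : s 0 = 3) : tCost E19 (L19 2) s 2 ≤ -3 := by
      have := h.tCost_le_exit_next (v := 2) (u := 0) (by simp [E19]) (by decide) nt0 (e ▸ t3)
      rwa [e] at this
    have step0 (i : Fin 3) := tCost_step (s := s) (L19 i) nt0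
    have step1 (i : Fin 3) := tCost_step (s := s) (L19 i) nt1
    have step2 (i : Fin 3) := tCost_step (s := s) (L19 i) nt2
    have end3 : tCost E19 (L19 0) s 3 = -2 ∧ tCost E19 (L19 1) s 3 = -1 ∧
        tCost E19 (L19 2) s 3 = -3 :=
      ⟨tCost_of_terminal _ t3, tCost_of_terminal _ t3, tCost_of_terminal _ t3⟩
    have end4 : tCost E19 (L19 0) s 4 = -3 ∧ tCost E19 (L19 1) s 4 = -2 ∧
        tCost E19 (L19 2) s 4 = -1 :=
      ⟨tCost_of_terminal _ t4, tCost_of_terminal _ t4, tCost_of_terminal _ t4⟩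
    have end5 : tCost E19 (L19 0) s 5 = -1 ∧ tCost E19 (L19 1) s 5 = -3 ∧
        tCost E19 (L19 2) s 5 = -2 :=
      ⟨tCost_of_terminal _ t5, tCost_of_terminal _ t5, tCost_of_terminal _ t5⟩
    have not_trapped0 (S : Set (Fin 6)) (h0 : 0 ∈ S) (hS : ∀ v ∈ S, v < 3 ∧ s v ∈ S) : False := by
      rw [tCost_of_mapsTo _ S (fun v hv => (hS v hv).2)
        (fun v hv => by rw [terminal_E19_iff]; exact not_le.2 (hS v hv).1) h0] at exit0
      norm_num at exit0
    have not_trapped1 (S : Set (Fin 6)) (h1 : 1 ∈ S) (hS : ∀ v ∈ S, v < 3 ∧ s v ∈ S) : False := by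
      rw [tCost_of_mapsTo _ S (fun v hv => (hS v hv).2)
        (fun v hv => by rw [terminal_E19_iff]; exact not_le.2 (hS v hv).1) h1] at exit1
      norm_num at exit1
    have hs0 : s 0 = 1 ∨ s 0 = 2 ∨ s 0 = 3 := by simpa [E19] using h.1 0 nt0
    have hs1 : s 1 = 0 ∨ s 1 = 2 ∨ s 1 = 4 := by simpa [E19] using h.1 1 nt1
    have hs2 : s 2 = 0 ∨ s 2 = 1 ∨ s 2 = 5 := by simpa [E19] using h.1 2 nt2
    rcases hs0 with e0 | e0 | e0 <;> rcases hs1 with e1 | e1 | e1 <;>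
      rcases hs2 with e2 | e2 | e2 <;>
      first
      | (refine not_trapped0 {0, 1} ?_ ?_ <;> simp [e0, e1] <;> done)
      | (refine not_trapped0 {0, 2} ?_ ?_ <;> simp [e0, e2] <;> done)
      | (refine not_trapped1 {1, 2} ?_ ?_ <;> simp [e1, e2] <;> done)
      | (refine not_trapped0 {0, 1, 2} ?_ ?_ <;> simp [e0, e1, e2] <;> done)
      | (rw [e0] at step0 next2
         rw [e1] at step1 next0
         rw [e2] at step2 next1
         try have := next0 rfl
         try have := next1 rfl
         try have := next2 rfl
         linarith [step0 0, step0 1, step0 2, step1 0, step1 1, step1 2,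
           step2 0, step2 1, step2 2])
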